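/- For every integer n ≥ 2, f(0,n−1,n) = (2^n · n / π) · arctan(1/√(n−1)). -/

import Mathlib

open MeasureTheory Filter Real

noncomputable section

/-- The orthogonal group O(n) of ℝⁿ. -/
abbrev OG (n : ℕ) : Type := Matrix.orthogonalGroup (Fin n) ℝ

instance (n : ℕ) : MeasurableSpace (OG n) := borel _
instance (n : ℕ) : BorelSpace (OG n) := ⟨rfl⟩

/-- The natural action of `g ∈ O(n)` on `ℝⁿ`. -/
def act {n : ℕ} (g : OG n) (x : EuclideanSpace ℝ (Fin n)) : EuclideanSpace ℝ (Fin n) :=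
  Matrix.toEuclideanLin (g : Matrix (Fin n) (Fin n) ℝ) x

/-- `E_k`: the span of the first `k` standard basis vectors of `ℝⁿ`, as a set. -/
def Ek (n k : ℕ) : Set (EuclideanSpace ℝ (Fin n)) :=
  {x | ∀ i : Fin n, k ≤ (i : ℕ) → x i = 0}

/-- The `m`-dimensional face `{x : |xᵢ| ≤ 1 for i < m, xᵢ = 1 for i ≥ m}` of the cube `[-1,1]ⁿ`. -/
def cubeFace (n m : ℕ) : Set (EuclideanSpace ℝ (Fin n)) :=
  {x | (∀ i : Fin n, (i : ℕ) < m → |x i| ≤ 1) ∧ ∀ i : Fin n, m ≤ (i : ℕ) → x i = 1}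

/-- `f(j,k,n)`, the expected number of `j`-faces of a random `k`-section of the `n`-cube,
computed with respect to the probability measure `H` on `O(n)`. -/
def expFaces (n : ℕ) (H : Measure (OG n)) (j k : ℕ) : ℝ :=
  2 ^ (k - j) * (n.choose (k - j)) *
    (H {g | (act g '' Ek n k ∩ cubeFace n (n - k + j)).Nonempty}).toReal

lemma aux_indicator_integral (c : ℝ) (hc : 0 < c) :
    ∫ x in (-(π / 2))..(π / 2), Set.indicator {x : ℝ | |sin x| ≤ c * |cos x|} (fun _ => (1 : ℝ)) x
      = 2 * arctan c := by
  have hm : MeasurableSet {x : ℝ | |sin x| ≤ c * |cos x|} :=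
    (isClosed_le (by fun_prop) (by fun_prop)).measurableSet
  rw [intervalIntegral.integral_of_le (by linarith [pi_pos]), integral_Ioc_eq_integral_Ioo,
    setIntegral_indicator hm]
  have : Set.Ioo (-(π / 2)) (π / 2) ∩ {x : ℝ | |sin x| ≤ c * |cos x|}
      = Set.Icc (-(arctan c)) (arctan c) := by
    ext x
    simp only [Set.mem_inter_iff, Set.mem_Ioo, Set.mem_setOf_eq, Set.mem_Icc]
    have key : ∀ x, -(π / 2) < x → x < π / 2 →
        (|sin x| ≤ c * |cos x| ↔ (-(arctan c) ≤ x ∧ x ≤ arctan c)) := by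
      intro x h1 h2
      have hcos : 0 < cos x := cos_pos_of_mem_Ioo ⟨h1, h2⟩
      have e1 : |sin x| ≤ c * |cos x| ↔ |tan x| ≤ c := by
        rw [tan_eq_sin_div_cos, abs_div, div_le_iff₀ (by positivity)]
      rw [e1, abs_le]
      have e2 : arctan (tan x) = x := arctan_tan h1 h2
      rw [← arctan_neg]
      constructor
      · rintro ⟨h, h'⟩
        rw [← e2]
        exact ⟨arctan_strictMono.monotone h, arctan_strictMono.monotone h'⟩
      · rintro ⟨h, h'⟩
        rw [← e2] at h h'
        exact ⟨arctan_strictMono.le_iff_le.1 h, arctan_strictMono.le_iff_le.1 h'⟩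
    constructor
    · rintro ⟨⟨h1, h2⟩, h⟩
      exact (key x h1 h2).1 h
    · rintro ⟨h1, h2⟩
      have h3 := arctan_lt_pi_div_two c
      have h1' : -(π / 2) < x := by linarith
      have h2' : x < π / 2 := by linarith
      exact ⟨⟨h1', h2'⟩, (key x h1' h2').2 ⟨h1, h2⟩⟩
  rw [this]
  have h0 : 0 < arctan c := by simpa using arctan_strictMono hc
  simp [measureReal_def, ENNReal.toReal_ofReal, h0.le]
  ring

lemma aux_angle (a b c : ℝ) (hc : 0 < c) (hab : a ≠ 0 ∨ b ≠ 0) :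
    (volume.restrict (Set.Ioc 0 π))
      {p : ℝ | |sin (2 * p) * a - cos (2 * p) * b| ≤ c * |cos (2 * p) * a + sin (2 * p) * b|}
      = ENNReal.ofReal (2 * arctan c) := by
  obtain ⟨r, α, hr, rfl, rfl⟩ : ∃ r α : ℝ, 0 < r ∧ a = r * cos α ∧ b = r * sin α := by
    refine ⟨‖(⟨a, b⟩ : ℂ)‖, Complex.arg ⟨a, b⟩, ?_, ?_, ?_⟩
    · rw [norm_pos_iff]
      intro h
      have h1 := congrArg Complex.re h
      have h2 := congrArg Complex.im h
      simp at h1 h2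
      tauto
    · exact (Complex.norm_mul_cos_arg ⟨a, b⟩).symm
    · exact (Complex.norm_mul_sin_arg ⟨a, b⟩).symm
  set S : Set ℝ := {x : ℝ | |sin x| ≤ c * |cos x|} with hS
  have hm : MeasurableSet S :=
    (isClosed_le (by fun_prop) (by fun_prop)).measurableSet
  have hset : {p : ℝ | |sin (2 * p) * (r * cos α) - cos (2 * p) * (r * sin α)| ≤
      c * |cos (2 * p) * (r * cos α) + sin (2 * p) * (r * sin α)|}
      = (fun p => 2 * p - α) ⁻¹' S := by
    ext p
    simp only [hS, Set.mem_setOf_eq, Set.mem_preimage]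
    rw [sin_sub, cos_sub]
    have e1 : sin (2 * p) * (r * cos α) - cos (2 * p) * (r * sin α)
      = r * (sin (2 * p) * cos α - cos (2 * p) * sin α) := by ring
    have e2 : cos (2 * p) * (r * cos α) + sin (2 * p) * (r * sin α)
      = r * (cos (2 * p) * cos α + sin (2 * p) * sin α) := by ring
    rw [e1, e2, abs_mul, abs_mul, abs_of_pos hr, mul_left_comm, mul_le_mul_iff_right₀ hr]
  rw [hset]
  have hm' : MeasurableSet ((fun p => 2 * p - α) ⁻¹' S) :=
    hm.preimage (by fun_prop)
  set f : ℝ → ℝ := S.indicator (fun _ => (1 : ℝ)) with hf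
  have hper : Function.Periodic f π := by
    intro x
    have : (x + π ∈ S) ↔ x ∈ S := by simp [hS]
    simp only [hf, Set.indicator, this]
  have hper2 : Function.Periodic f (2 * π) := by
    have := hper.nat_mul 2
    simpa using this
  have hint : ∀ u v, IntervalIntegrable f volume u v := by
    intro u v
    have hc1 : IntervalIntegrable (fun _ : ℝ => (1 : ℝ)) volume u v := intervalIntegrable_const
    rw [intervalIntegrable_iff] at hc1 ⊢
    exact Integrable.indicator hc1 hm
  have I1 : ∫ p in (0 : ℝ)..π, f (2 * p - α) = 2 * arctan c := by
    rw [intervalIntegral.integral_comp_mul_sub _ two_ne_zero]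
    have h1 := hper2.intervalIntegral_add_eq (2 * 0 - α) (-(π / 2))
    have h2 := hper.intervalIntegral_add_eq (π / 2) (-(π / 2))
    have h3 := intervalIntegral.integral_add_adjacent_intervals (hint (-(π / 2)) (π / 2))
      (hint (π / 2) (π / 2 + π))
    have h4 := aux_indicator_integral c hc
    rw [show 2 * 0 - α + 2 * π = 2 * π - α by ring,
      show -(π / 2) + 2 * π = π / 2 + π by ring] at h1
    rw [show -(π / 2) + π = π / 2 by ring] at h2
    rw [h1, ← h3, h2, h4]
    simp only [smul_eq_mul]
    ring
  have I2 : ∫ p in (0 : ℝ)..π, f (2 * p - α) =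
      ((volume.restrict (Set.Ioc 0 π)) ((fun p => 2 * p - α) ⁻¹' S)).toReal := by
    rw [intervalIntegral.integral_of_le pi_pos.le]
    have : (fun p => f (2 * p - α)) =
      ((fun p => 2 * p - α) ⁻¹' S).indicator (fun _ => (1 : ℝ)) := by
      ext p; simp [hf, Set.indicator]
    rw [this, integral_indicator_const _ hm']
    simp [measureReal_def]
  rw [← I1, I2, ENNReal.ofReal_toReal]
  exact measure_ne_top _ _

section abs
variable {E : Type*} [NormedAddCommGroup E] [InnerProductSpace ℝ E] [FiniteDimensional ℝ E]
  [MeasurableSpace E] [BorelSpace E]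

lemma aux_null (μ : Measure E) [IsProbabilityMeasure μ]
    (hμ : ∀ T : E ≃ₗᵢ[ℝ] E, MeasurePreserving T μ μ) (h0 : ∀ᵐ u ∂μ, u ≠ 0)
    (e : E) (he : ‖e‖ = 1) : μ {u | inner ℝ e u = 0} = 0 := by
  have : Nontrivial E := ⟨e, 0, by rintro rfl; simp at he⟩
  have hB : MeasurableSet {q : E × E | inner ℝ q.1 q.2 = 0} :=
    (isClosed_eq (by fun_prop) (by fun_prop)).measurableSet
  have h1 : ((volume : Measure E).prod μ) {q : E × E | inner ℝ q.1 q.2 = 0} = 0 := by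
    rw [Measure.prod_apply_symm hB, lintegral_eq_zero_iff' (by
      exact (measurable_measure_prodMk_right hB).aemeasurable)]
    filter_upwards [h0] with u hu
    have : ((fun v : E => (v, u)) ⁻¹' {q : E × E | inner ℝ q.1 q.2 = 0})
      = ((ℝ ∙ u)ᗮ : Submodule ℝ E) := by
      ext v
      simp [Submodule.mem_orthogonal_singleton_iff_inner_left]
    rw [this]
    apply Measure.addHaar_submodule
    intro h
    have : u ∈ (ℝ ∙ u)ᗮ := by rw [h]; trivial
    rw [Submodule.mem_orthogonal_singleton_iff_inner_left] at this
    exact hu (inner_self_eq_zero.1 this)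
  have h2 := (Measure.measure_prod_null hB).1 h1
  have h3 : ∀ᵐ v : E ∂volume, v ≠ 0 := by
    rw [ae_iff]; simp
  obtain ⟨v, hv, hv0⟩ := (h2.and h3).exists
  have hn : ‖‖v‖ • e‖ = ‖v‖ := by simp [norm_smul, he]
  have hT := Submodule.reflection_sub hn
  set T := Submodule.reflection (ℝ ∙ (‖v‖ • e - v))ᗮ
  have hmeas : MeasurableSet {u : E | inner ℝ v u = 0} :=
    (isClosed_eq (by fun_prop) (by fun_prop)).measurableSet
  have h4 := (hμ T).measure_preimage hmeas.nullMeasurableSet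
  have h5 : T ⁻¹' {u : E | inner ℝ v u = 0} = {u | inner ℝ e u = 0} := by
    ext u
    simp only [Set.mem_preimage, Set.mem_setOf_eq]
    rw [← hT, LinearIsometryEquiv.inner_map_map, inner_smul_left]
    simp [hv0]
  rw [← h5, h4]
  exact hv

lemma aux_key (μ : Measure E) [IsProbabilityMeasure μ]
    (hμ : ∀ T : E ≃ₗᵢ[ℝ] E, MeasurePreserving T μ μ) (h0 : ∀ᵐ u ∂μ, u ≠ 0)
    (e w : E) (he : ‖e‖ = 1) (hw : ‖w‖ = 1) (hew : inner ℝ e w = 0) (c : ℝ) (hc : 0 < c) :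
    μ {u | |inner ℝ w u| ≤ c * |inner ℝ e u|} = ENNReal.ofReal (2 * arctan c / π) := by
  set A : Set E := {u | |inner ℝ w u| ≤ c * |inner ℝ e u|} with hA
  have hAm : MeasurableSet A := (isClosed_le (by fun_prop) (by fun_prop)).measurableSet
  set B : Set (ℝ × E) := {q | |sin (2 * q.1) * inner ℝ e q.2 - cos (2 * q.1) * inner ℝ w q.2| ≤
    c * |cos (2 * q.1) * inner ℝ e q.2 + sin (2 * q.1) * inner ℝ w q.2|} with hB
  have hBm : MeasurableSet B := (isClosed_le (by fun_prop) (by fun_prop)).measurableSet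
  set ν : Measure ℝ := volume.restrict (Set.Ioc 0 π) with hν
  have hee : inner ℝ e e = 1 := by rw [real_inner_self_eq_norm_sq, he]; norm_num
  have hww : inner ℝ w w = 1 := by rw [real_inner_self_eq_norm_sq, hw]; norm_num
  have hwe : inner ℝ w e = 0 := by rw [real_inner_comm, hew]
  have h1 : (ν.prod μ) B = ENNReal.ofReal π * μ A := by
    rw [Measure.prod_apply hBm]
    have : ∀ p : ℝ, μ (Prod.mk p ⁻¹' B) = μ A := by
      intro p
      set v := cos p • e + sin p • w with hv
      have hvv : ‖v‖ = 1 := by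
        have : ‖v‖ ^ 2 = 1 := by
          rw [← real_inner_self_eq_norm_sq, hv]
          simp only [inner_add_left, inner_add_right, inner_smul_left, inner_smul_right, hee, hww,
            hew, hwe]
          simp
          nlinarith [sin_sq_add_cos_sq p]
        nlinarith [norm_nonneg v]
      rw [← (hμ (Submodule.reflection (ℝ ∙ v))).measure_preimage hAm.nullMeasurableSet]
      congr 1
      ext u
      simp only [hA, hB, Set.mem_preimage, Set.mem_setOf_eq]
      rw [Submodule.reflection_singleton_apply, hvv]
      have hvu : inner ℝ v u = cos p * inner ℝ e u + sin p * inner ℝ w u := by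
        simp [hv, inner_add_left, inner_smul_left]
      have hev : inner ℝ e v = cos p := by
        simp [hv, inner_add_right, inner_smul_right, hew, he]
      have hwv : inner ℝ w v = sin p := by
        simp [hv, inner_add_right, inner_smul_right, hwe, hw]
      have E1 : inner ℝ e (2 • (inner ℝ v u / (((1 : ℝ) : ℝ) ^ 2)) • v - u) =
          cos (2 * p) * inner ℝ e u + sin (2 * p) * inner ℝ w u := by
        rw [two_smul, inner_sub_right, inner_add_right, inner_smul_right, hev, hvu, sin_two_mul,
          cos_two_mul]
        ring
      have E2 : inner ℝ w (2 • (inner ℝ v u / (((1 : ℝ) : ℝ) ^ 2)) • v - u) =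
          sin (2 * p) * inner ℝ e u - cos (2 * p) * inner ℝ w u := by
        rw [two_smul, inner_sub_right, inner_add_right, inner_smul_right, hwv, hvu, sin_two_mul,
          cos_two_mul']
        linear_combination (inner ℝ w u) * sin_sq_add_cos_sq p
      simp only [RCLike.ofReal_real_eq_id, id] at *
      rw [E1, E2]
    simp only [this]
    rw [lintegral_const, mul_comm]
    simp [hν]
  have h2 : (ν.prod μ) B = ENNReal.ofReal (2 * arctan c) := by
    rw [Measure.prod_apply_symm hBm]
    have hae : ∀ᵐ u ∂μ, inner ℝ e u ≠ 0 := by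
      rw [ae_iff]; simpa using aux_null μ hμ h0 e he
    rw [lintegral_congr_ae (g := fun _ => ENNReal.ofReal (2 * arctan c))]
    · simp
    · filter_upwards [hae] with u hu
      exact aux_angle _ (inner ℝ w u) c hc (Or.inl hu)
  have hπ : ENNReal.ofReal π ≠ 0 := by simpa using pi_pos
  rw [ENNReal.ofReal_div_of_pos pi_pos, ← h2, h1, mul_comm,
    ENNReal.mul_div_cancel_right hπ ENNReal.ofReal_ne_top]

end abs

lemma act_mul {n : ℕ} (g h : OG n) (x : EuclideanSpace ℝ (Fin n)) :
    act (g * h) x = act g (act h x) := by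
  simp [act, Matrix.toEuclideanLin_apply, Matrix.mulVec_mulVec]

lemma act_inner {n : ℕ} (g : OG n) (x y : EuclideanSpace ℝ (Fin n)) :
    inner ℝ (act g x) (act g y) = inner ℝ x y := by
  have h := (Matrix.mem_orthogonalGroup_iff' (Fin n) ℝ).1 g.2
  simp only [act, EuclideanSpace.inner_eq_star_dotProduct, Matrix.ofLp_toEuclideanLin_apply,
    star_trivial]
  rw [Matrix.dotProduct_mulVec, ← Matrix.mulVec_transpose, Matrix.mulVec_mulVec]
  have h' : (g : Matrix (Fin n) (Fin n) ℝ).transpose * g = 1 := h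
  rw [h', Matrix.one_mulVec]

lemma exists_act {n : ℕ} (T : EuclideanSpace ℝ (Fin n) ≃ₗᵢ[ℝ] EuclideanSpace ℝ (Fin n)) :
    ∃ g : OG n, ∀ x, act g x = T x := by
  let b := EuclideanSpace.basisFun (Fin n) ℝ
  refine ⟨⟨LinearMap.toMatrix b.toBasis b.toBasis T.toLinearMap,
    T.toMatrix_mem_unitaryGroup b b⟩, fun x => ?_⟩
  simp only [act]
  rw [Matrix.toEuclideanLin_eq_toLin_orthonormal, Matrix.toLin_toMatrix]
  rfl

lemma act_continuous {n : ℕ} (x : EuclideanSpace ℝ (Fin n)) :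
    Continuous (fun g : OG n => act g x) := by
  simp only [act, Matrix.toEuclideanLin_apply]
  refine (PiLp.continuous_toLp 2 _).comp ?_
  exact Continuous.matrix_mulVec continuous_subtype_val continuous_const

lemma section_iff {m : ℕ} (g : OG (m + 1)) :
    (act g '' Ek (m + 1) m ∩ cubeFace (m + 1) 1).Nonempty ↔
      |∑ i : Fin m, act g (EuclideanSpace.single (Fin.last m) 1) i.succ| ≤
        |act g (EuclideanSpace.single (Fin.last m) 1) 0| := by
  set u := act g (EuclideanSpace.single (Fin.last m) 1) with hu
  have hE : ∀ x, x ∈ Ek (m + 1) m ↔ inner ℝ u (act g x) = 0 := by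
    intro x
    rw [hu, act_inner, EuclideanSpace.inner_single_left]
    simp only [Ek, Set.mem_setOf_eq, map_one, one_mul]
    constructor
    · intro h; exact h _ (by simp)
    · intro h i hi
      have : i = Fin.last m := by ext; simp; omega
      rw [this, h]
  have hF : ∀ y, y ∈ cubeFace (m + 1) 1 ↔ |y 0| ≤ 1 ∧ ∀ i : Fin m, y i.succ = 1 := by
    intro y
    simp [cubeFace, Fin.forall_fin_succ]
  have hin : ∀ y : EuclideanSpace ℝ (Fin (m + 1)), inner ℝ u y =
      u 0 * y 0 + ∑ i : Fin m, u i.succ * y i.succ := by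
    intro y
    rw [PiLp.inner_apply, Fin.sum_univ_succ]
    simp [mul_comm]
  constructor
  · rintro ⟨_, ⟨x, hx, rfl⟩, hy⟩
    rw [hE, hin] at hx
    rw [hF] at hy
    simp only [hy.2, mul_one] at hx
    have : ∑ i : Fin m, u i.succ = - (u 0 * act g x 0) := by linarith
    rw [this, abs_neg, abs_mul]
    exact mul_le_of_le_one_right (abs_nonneg _) hy.1
  · intro h
    obtain ⟨t, ht, hts⟩ : ∃ t : ℝ, |t| ≤ 1 ∧ u 0 * t + ∑ i : Fin m, u i.succ = 0 := by
      by_cases h0 : u 0 = 0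
      · refine ⟨0, by simp, ?_⟩
        rw [h0, abs_zero] at h
        rw [abs_nonpos_iff.1 h]; simp
      · refine ⟨-(∑ i : Fin m, u i.succ) / u 0, ?_, by field_simp; ring⟩
        rw [abs_div, abs_neg]
        exact div_le_one_of_le₀ h (abs_nonneg _)
    let y : EuclideanSpace ℝ (Fin (m + 1)) := WithLp.toLp 2 (Fin.cons t fun _ => 1)
    have hg : act g (act g⁻¹ y) = y := by
      rw [← act_mul]; simp [act]
    refine ⟨y, ⟨act g⁻¹ y, ?_, hg⟩, ?_⟩
    · rw [hE, hg, hin]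
      simpa [y] using hts
    · rw [hF]; simpa [y] using ht

/-- `f(0,n-1,n) = (2ⁿ n / π) arctan(1/√(n-1))` for `n ≥ 2`. -/
theorem expected_vertices_hyperplane_section (n : ℕ) (hn : 2 ≤ n)
    (H : Measure (OG n)) [H.IsHaarMeasure] [IsProbabilityMeasure H] :
    expFaces n H 0 (n - 1) =
      (2 ^ n * n / π) * Real.arctan (1 / Real.sqrt (n - 1)) := by
  obtain ⟨m, rfl⟩ : ∃ m, n = m + 1 := ⟨n - 1, by omega⟩
  have hm : 0 < m := by omega
  have hmR : (0 : ℝ) < m := by exact_mod_cast hm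
  have hs : 0 < √(m : ℝ) := Real.sqrt_pos.2 hmR
  have hss : √(m : ℝ) * √(m : ℝ) = m := Real.mul_self_sqrt hmR.le
  let e₁ : EuclideanSpace ℝ (Fin (m + 1)) := EuclideanSpace.single (Fin.last m) 1
  let F : OG (m + 1) → EuclideanSpace ℝ (Fin (m + 1)) := fun g => act g e₁
  have hF : Measurable F := (act_continuous e₁).measurable
  let μ : Measure (EuclideanSpace ℝ (Fin (m + 1))) := H.map F
  have : IsProbabilityMeasure μ := Measure.isProbabilityMeasure_map hF.aemeasurable
  have hμ : ∀ T : EuclideanSpace ℝ (Fin (m + 1)) ≃ₗᵢ[ℝ] EuclideanSpace ℝ (Fin (m + 1)), MeasurePreserving T μ μ := by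
    intro T
    refine ⟨T.continuous.measurable, ?_⟩
    obtain ⟨g, hg⟩ := exists_act T
    rw [Measure.map_map T.continuous.measurable hF]
    have : T ∘ F = F ∘ (fun h => g * h) := by
      ext1 h
      simp only [Function.comp, F, act_mul, hg]
    rw [this, ← Measure.map_map hF (measurable_const_mul g), map_mul_left_eq_self]
  have h0 : ∀ᵐ u ∂μ, u ≠ 0 := by
    refine (ae_map_iff hF.aemeasurable
      (measurableSet_singleton (0 : EuclideanSpace ℝ (Fin (m + 1)))).compl).2 ?_
    refine Eventually.of_forall fun g h => ?_
    have h1 := act_inner g e₁ e₁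
    have h2 : act g e₁ = 0 := h
    rw [h2] at h1
    simp [e₁] at h1
  let e : EuclideanSpace ℝ (Fin (m + 1)) := EuclideanSpace.single 0 1
  let w : EuclideanSpace ℝ (Fin (m + 1)) := WithLp.toLp 2 (Fin.cons 0 fun _ => 1 / √(m : ℝ))
  have he : ‖e‖ = 1 := by simp [e]
  have hw : ‖w‖ = 1 := by
    rw [EuclideanSpace.norm_eq, Fin.sum_univ_succ]
    simp [w, hmR.ne']
  have hew : inner ℝ e w = 0 := by
    simp [e, w, EuclideanSpace.inner_single_left]
  have key := aux_key μ hμ h0 e w he hw hew (1 / √(m : ℝ)) (by positivity)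
  rw [Measure.map_apply hF (isClosed_le (by fun_prop) (by fun_prop)).measurableSet] at key
  have hset : {g : OG (m + 1) | (act g '' Ek (m + 1) (m + 1 - 1) ∩
      cubeFace (m + 1) (m + 1 - (m + 1 - 1) + 0)).Nonempty} =
      F ⁻¹' {u | |inner ℝ w u| ≤ 1 / √(m : ℝ) * |inner ℝ e u|} := by
    ext g
    have e1 : m + 1 - (m + 1 - 1) + 0 = 1 := by omega
    rw [e1, Nat.add_sub_cancel]
    simp only [Set.mem_setOf_eq, Set.mem_preimage]
    rw [section_iff]
    have i1 : inner ℝ e (F g) = F g 0 := by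
      simp [e, EuclideanSpace.inner_single_left]
    have i2 : inner ℝ w (F g) = 1 / √(m : ℝ) * ∑ i : Fin m, F g i.succ := by
      rw [PiLp.inner_apply, Fin.sum_univ_succ, Finset.mul_sum]
      simp [w, mul_comm]
    rw [i1, i2, abs_mul, abs_of_pos (show 0 < 1 / √(m : ℝ) by positivity),
      mul_le_mul_iff_right₀ (by positivity)]
  have hat : 0 ≤ arctan (1 / √(m : ℝ)) := by
    rw [Real.arctan_nonneg]; positivity
  unfold expFaces
  rw [hset, key, ENNReal.toReal_ofReal (by positivity)]
  have hc : (m + 1).choose (m + 1 - 1 - 0) = m + 1 := by simp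
  rw [hc]
  push_cast
  simp only [Nat.add_sub_cancel, Nat.sub_zero, add_sub_cancel_right]
  rw [pow_succ]
  ring
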